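/- Let k, R be real numbers with R > 0, let L₁ be the x-axis in ℝ³, and let C = {(u,v,k) ∈ ℝ³ : u² + v² = R²}. Then a point (x,y,z) ∈ ℝ³ is equidistant from L₁ and C if and only if 2R·√(x² + y²) = x² − 2kz + R² + k²; in particular, every point equidistant from L₁ and C satisfies F₂(x,y,z) = (x² − 2kz + R² + k²)² − 4R²(x² + y²) = 0. -/

import Mathlib

/-- The point `(x, y, z)` of Euclidean 3-space. -/
noncomputable def pt (x y z : ℝ) : EuclideanSpace ℝ (Fin 3) :=
  (WithLp.equiv 2 (Fin 3 → ℝ)).symm ![x, y, z]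

/-- The line–circle bisector polynomial `F₂`. -/
def F₂ (k R x y z : ℝ) : ℝ :=
  (x ^ 2 - 2 * k * z + R ^ 2 + k ^ 2) ^ 2 - 4 * R ^ 2 * (x ^ 2 + y ^ 2)

theorem dist_pt (x y z u v w : ℝ) :
    dist (pt x y z) (pt u v w) = √((x - u) ^ 2 + (y - v) ^ 2 + (z - w) ^ 2) := by
  simp [pt, EuclideanSpace.dist_eq, Fin.sum_univ_three, Real.dist_eq, sq_abs]

theorem Metric.infDist_eq_dist_of_forall_le {α : Type*} [PseudoMetricSpace α] {s : Set α}
    {a p : α} (hp : p ∈ s) (h : ∀ q ∈ s, dist a p ≤ dist a q) :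
    Metric.infDist a s = dist a p :=
  le_antisymm (Metric.infDist_le_dist_of_mem hp) ((Metric.le_infDist ⟨p, hp⟩).2 fun {q} => h q)

/-- The distance from a point to the `x`-axis. -/
theorem infDist_xAxis (x y z : ℝ) :
    Metric.infDist (pt x y z) {p | ∃ t : ℝ, p = pt t 0 0} = √(y ^ 2 + z ^ 2) := by
  have hp : pt x 0 0 ∈ {p | ∃ t : ℝ, p = pt t 0 0} := ⟨x, rfl⟩
  rw [Metric.infDist_eq_dist_of_forall_le hp, dist_pt]
  · simp
  · rintro _ ⟨t, rfl⟩
    rw [dist_pt, dist_pt]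
    apply Real.sqrt_le_sqrt
    nlinarith [sq_nonneg (x - t)]

/-- Cauchy–Schwarz in the plane, for a vector on the circle of radius `R`. -/
theorem mul_add_mul_le_of_sq_add_sq_eq {R u v : ℝ} (hR : 0 ≤ R) (h : u ^ 2 + v ^ 2 = R ^ 2)
    (x y : ℝ) : x * u + y * v ≤ √(x ^ 2 + y ^ 2) * R := by
  refine abs_le_of_sq_le_sq' ?_ (by positivity) |>.2
  rw [mul_pow, Real.sq_sqrt (by positivity), ← h]
  nlinarith [sq_nonneg (x * v - y * u)]

theorem exists_sq_add_sq_eq_and_mul_add_mul_eq (R x y : ℝ) :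
    ∃ u v : ℝ, u ^ 2 + v ^ 2 = R ^ 2 ∧ x * u + y * v = √(x ^ 2 + y ^ 2) * R := by
  have hs : √(x ^ 2 + y ^ 2) ^ 2 = x ^ 2 + y ^ 2 := Real.sq_sqrt (by positivity)
  rcases eq_or_ne √(x ^ 2 + y ^ 2) 0 with h0 | h0
  · rw [h0] at hs
    have hx : x = 0 := by nlinarith
    have hy : y = 0 := by nlinarith
    exact ⟨R, 0, by ring, by simp [hx, hy]⟩
  · refine ⟨R * x / √(x ^ 2 + y ^ 2), R * y / √(x ^ 2 + y ^ 2), ?_, ?_⟩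
    · rw [div_pow, div_pow, ← add_div, div_eq_iff (pow_ne_zero 2 h0), hs]
      ring
    · rw [mul_div_assoc', mul_div_assoc', ← add_div, div_eq_iff h0]
      linear_combination -R * hs

/-- The distance from a point to the circle of radius `R` about `(0, 0, k)` in the plane
`z = k`. -/
theorem infDist_circle {R : ℝ} (hR : 0 ≤ R) (k x y z : ℝ) :
    Metric.infDist (pt x y z) {p | ∃ u v : ℝ, u ^ 2 + v ^ 2 = R ^ 2 ∧ p = pt u v k} =
      √((√(x ^ 2 + y ^ 2) - R) ^ 2 + (z - k) ^ 2) := by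
  have hs : √(x ^ 2 + y ^ 2) ^ 2 = x ^ 2 + y ^ 2 := Real.sq_sqrt (by positivity)
  obtain ⟨u, v, huv, hxy⟩ := exists_sq_add_sq_eq_and_mul_add_mul_eq R x y
  have hp : pt u v k ∈ {p | ∃ u v : ℝ, u ^ 2 + v ^ 2 = R ^ 2 ∧ p = pt u v k} :=
    ⟨u, v, huv, rfl⟩
  rw [Metric.infDist_eq_dist_of_forall_le hp, dist_pt]
  · congr 1
    linear_combination huv - 2 * hxy - hs
  · rintro _ ⟨u', v', huv', rfl⟩
    rw [dist_pt, dist_pt]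
    apply Real.sqrt_le_sqrt
    nlinarith [mul_add_mul_le_of_sq_add_sq_eq hR huv' x y]

/-- A point `(x,y,z)` is equidistant from the x-axis `L₁` and from the circle `C` of
radius `R > 0` centered at `(0,0,k)` in the plane `z = k` if and only if
`2R·√(x² + y²) = x² − 2kz + R² + k²`; in particular every such point satisfies
`F₂(x,y,z) = (x² − 2kz + R² + k²)² − 4R²(x² + y²) = 0`. -/
theorem line_circle_bisector (k R : ℝ) (hR : 0 < R)
    (L₁ C : Set (EuclideanSpace ℝ (Fin 3)))
    (hL₁ : L₁ = {p | ∃ t : ℝ, p = pt t 0 0})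
    (hC : C = {p | ∃ u v : ℝ, u ^ 2 + v ^ 2 = R ^ 2 ∧ p = pt u v k})
    (x y z : ℝ) :
    (Metric.infDist (pt x y z) L₁ = Metric.infDist (pt x y z) C ↔
      2 * R * Real.sqrt (x ^ 2 + y ^ 2) = x ^ 2 - 2 * k * z + R ^ 2 + k ^ 2) ∧
    (Metric.infDist (pt x y z) L₁ = Metric.infDist (pt x y z) C →
      F₂ k R x y z = 0) := by
  have hs : √(x ^ 2 + y ^ 2) ^ 2 = x ^ 2 + y ^ 2 := Real.sq_sqrt (by positivity)
  have key : Metric.infDist (pt x y z) L₁ = Metric.infDist (pt x y z) C ↔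
      2 * R * √(x ^ 2 + y ^ 2) = x ^ 2 - 2 * k * z + R ^ 2 + k ^ 2 := by
    rw [hL₁, hC, infDist_xAxis, infDist_circle hR.le, Real.sqrt_inj (by positivity) (by positivity)]
    constructor <;> intro h
    · linear_combination h + hs
    · linear_combination h - hs
  refine ⟨key, fun h => ?_⟩
  rw [F₂, ← key.1 h]
  linear_combination 4 * R ^ 2 * hs
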